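/- arXiv:1504.05106 — 3 statements merged into one kernel-verified Lean document; each statement's English description precedes it below -/
import Mathlib

section
/- Let (X,Y) be a centered complex Gaussian vector (i.e., (Re X, Im X, Re Y, Im Y) is a real centered Gaussian vector in ℝ⁴) with E[X²] = E[Y²] = 0, E[|X|²] = σ_X, E[|Y|²] = σ_Y, E[XY] = σ_{XY}, E[X·conj(Y)] = 0. Then for every integer p ≥ 1, E[(XY)^p] = p! · σ_{XY}^p. -/
open MeasureTheory ProbabilityTheory

/-- Gaussian integration by parts, obtained by differentiating the identity `dM/dt = v t M` for
the moment generating function `M`. -/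
lemma integral_pow_add_two_mul_exp_gaussianReal (v : NNReal) (n : ℕ) (t : ℝ) :
    ∫ x, x ^ (n + 2) * Real.exp (t * x) ∂gaussianReal 0 v =
      v * t * ∫ x, x ^ (n + 1) * Real.exp (t * x) ∂gaussianReal 0 v +
        (n + 1) * v * ∫ x, x ^ n * Real.exp (t * x) ∂gaussianReal 0 v := by
  set F : ℕ → ℝ → ℝ := fun n t => ∫ x, x ^ n * Real.exp (t * x) ∂gaussianReal 0 v with hF
  have hderiv : ∀ n t, HasDerivAt (F n) (F (n + 1) t) t := fun n t =>
    hasDerivAt_integral_pow_mul_exp_real (X := fun x => x) (by simp) n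
  have h_one : ∀ t, F 1 t = v * t * F 0 t := by
    intro t
    have h0 : F 0 = fun t => Real.exp (v * t ^ 2 / 2) := by
      ext t
      have := congrFun (mgf_fun_id_gaussianReal (μ := 0) (v := v)) t
      simpa [mgf, hF] using this
    have h1 : HasDerivAt (F 0) (Real.exp (v * t ^ 2 / 2) * (v * (2 * t) / 2)) t := by
      rw [h0]
      simpa using ((((hasDerivAt_id t).pow 2).const_mul (v : ℝ)).div_const 2).exp
    rw [(hderiv 0 t).unique h1, h0]
    ring
  have h_rec : ∀ n t, F (n + 2) t = v * t * F (n + 1) t + (n + 1) * v * F n t := by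
    intro n
    induction n with
    | zero =>
      intro t
      have h := (((hasDerivAt_id t).const_mul (v : ℝ)).mul (hderiv 0 t))
      have h' := (hderiv 1 t).congr_of_eventuallyEq
        (Filter.Eventually.of_forall fun s => (h_one s).symm)
      rw [h'.unique h]
      simp
      ring
    | succ n ih =>
      intro t
      have h := (((hasDerivAt_id t).const_mul (v : ℝ)).mul (hderiv (n + 1) t)).add
        ((hderiv n t).const_mul (((n : ℝ) + 1) * v))
      have h' := (hderiv (n + 2) t).congr_of_eventuallyEq
        (Filter.Eventually.of_forall fun s => (ih s).symm)
      rw [h'.unique h]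
      simp
      ring
  exact h_rec n t

lemma integral_even_pow_gaussianReal (v : NNReal) (p : ℕ) :
    2 ^ p * p.factorial * ∫ x, x ^ (2 * p) ∂gaussianReal 0 v =
      (2 * p).factorial * (v : ℝ) ^ p := by
  induction p with
  | zero => simp
  | succ p ih =>
    have h := integral_pow_add_two_mul_exp_gaussianReal v (2 * p) 0
    simp only [zero_mul, Real.exp_zero, mul_one, mul_zero, zero_add] at h
    rw [show 2 * (p + 1) = 2 * p + 2 by ring, h, Nat.factorial_succ, Nat.factorial_succ,
      Nat.factorial_succ]
    push_cast
    linear_combination 2 * ((p : ℝ) + 1) * (2 * p + 1) * v * ih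

lemma aemeasurable_of_map_eq_gaussianReal {Ω : Type*} [MeasurableSpace Ω] {μ : Measure Ω}
    {Z : Ω → ℝ} {m : ℝ} {v : NNReal} (h : μ.map Z = gaussianReal m v) : AEMeasurable Z μ := by
  refine AEMeasurable.of_map_ne_zero ?_
  rw [h]
  exact IsProbabilityMeasure.ne_zero _

lemma integral_even_pow_of_map_eq_gaussianReal {Ω : Type*} [MeasurableSpace Ω] {μ : Measure Ω}
    {Z : Ω → ℝ} {v : NNReal} (h : μ.map Z = gaussianReal 0 v) (p : ℕ) :
    2 ^ p * p.factorial * ∫ ω, Z ω ^ (2 * p) ∂μ =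
      (2 * p).factorial * (∫ ω, Z ω ^ 2 ∂μ) ^ p := by
  have hZ := aemeasurable_of_map_eq_gaussianReal h
  have hmap (n : ℕ) : ∫ ω, Z ω ^ n ∂μ = ∫ x, x ^ n ∂gaussianReal 0 v := by
    rw [← h, integral_map hZ (by fun_prop)]
  have h2 := integral_even_pow_gaussianReal v 1
  norm_num at h2
  rw [hmap, hmap, integral_even_pow_gaussianReal, h2]

section Moments

variable {Ω : Type*} [MeasurableSpace Ω] {μ : Measure Ω}

/-- All moments of `f` are finite. -/
def HasFiniteMoments (f : Ω → ℂ) (μ : Measure Ω) : Prop :=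
  ∀ n : ℕ, MemLp f n μ

namespace HasFiniteMoments

variable {f g : Ω → ℂ}

lemma add (hf : HasFiniteMoments f μ) (hg : HasFiniteMoments g μ) :
    HasFiniteMoments (fun ω => f ω + g ω) μ :=
  fun n => (hf n).add (hg n)

lemma const_mul (hf : HasFiniteMoments f μ) (c : ℂ) :
    HasFiniteMoments (fun ω => c * f ω) μ :=
  fun n => (hf n).const_mul c

lemma mul (hf : HasFiniteMoments f μ) (hg : HasFiniteMoments g μ) :
    HasFiniteMoments (fun ω => f ω * g ω) μ := by
  intro n
  have : ENNReal.HolderTriple ((2 * n : ℕ) : ENNReal) ((2 * n : ℕ) : ENNReal) (n : ENNReal) := by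
    constructor
    push_cast
    rw [ENNReal.mul_inv (by simp) (by simp), ← add_mul, ENNReal.inv_two_add_inv_two, one_mul]
  exact (hg (2 * n)).mul' (hf (2 * n))

lemma pow [IsProbabilityMeasure μ] (hf : HasFiniteMoments f μ) (k : ℕ) :
    HasFiniteMoments (fun ω => f ω ^ k) μ := by
  induction k with
  | zero => exact fun n => by simpa using memLp_const (1 : ℂ)
  | succ k ih => simpa only [pow_succ] using ih.mul hf

lemma integrable (hf : HasFiniteMoments f μ) : Integrable f μ := by
  simpa [memLp_one_iff_integrable] using hf 1

end HasFiniteMoments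

lemma hasFiniteMoments_ofReal_of_map_eq_gaussianReal {Z : Ω → ℝ} {m : ℝ} {v : NNReal}
    (h : μ.map Z = gaussianReal m v) : HasFiniteMoments (fun ω => (Z ω : ℂ)) μ := by
  have hZ := aemeasurable_of_map_eq_gaussianReal h
  intro n
  have h1 : MemLp id (n : ENNReal) (μ.map Z) := by
    rw [h]
    exact memLp_id_gaussianReal' _ (by simp)
  exact ((memLp_map_measure_iff (by fun_prop) hZ).1 h1).ofReal

open Polynomial in
/-- `z ↦ E[(f + z g)ⁿ]` as a polynomial. -/
noncomputable def momentPolynomial (f g : Ω → ℂ) (μ : Measure Ω) (n : ℕ) : ℂ[X] :=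
  ∑ k ∈ Finset.range (n + 1),
    C (n.choose k * ∫ ω, f ω ^ (n - k) * g ω ^ k ∂μ) * X ^ k

variable {f g : Ω → ℂ}

open Polynomial in
lemma coeff_momentPolynomial (n k : ℕ) (hk : k ≤ n) :
    (momentPolynomial f g μ n).coeff k = n.choose k * ∫ ω, f ω ^ (n - k) * g ω ^ k ∂μ := by
  simp only [momentPolynomial, finsetSum_coeff, coeff_C_mul_X_pow]
  rw [Finset.sum_ite_eq, if_pos (Finset.mem_range.2 (by omega))]

/-- The relation between even moments and the variance which holds for centred Gaussians. -/
def EvenMomentRelation (f : Ω → ℂ) (μ : Measure Ω) (p : ℕ) : Prop :=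
  2 ^ p * p.factorial * ∫ ω, f ω ^ (2 * p) ∂μ = (2 * p).factorial * (∫ ω, f ω ^ 2 ∂μ) ^ p

variable [IsProbabilityMeasure μ]

lemma eval_momentPolynomial (hf : HasFiniteMoments f μ) (hg : HasFiniteMoments g μ) (n : ℕ)
    (z : ℂ) :
    (momentPolynomial f g μ n).eval z = ∫ ω, (f ω + z * g ω) ^ n ∂μ := by
  have hexp (ω : Ω) : (f ω + z * g ω) ^ n = ∑ k ∈ Finset.range (n + 1),
      (z ^ k * n.choose k) * (f ω ^ (n - k) * g ω ^ k) := by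
    rw [add_comm, add_pow]
    refine Finset.sum_congr rfl fun k _ => ?_
    ring
  simp_rw [hexp]
  rw [integral_finsetSum _ fun k _ =>
    (((hf.pow (n - k)).mul (hg.pow k)).const_mul (z ^ k * n.choose k)).integrable]
  simp only [momentPolynomial, Polynomial.eval_finsetSum, integral_const_mul]
  refine Finset.sum_congr rfl fun k _ => ?_
  simp
  ring

/-- A polynomial identity valid for real parameters is valid for complex ones. -/
lemma EvenMomentRelation.of_real {p : ℕ} (hf : HasFiniteMoments f μ) (hg : HasFiniteMoments g μ)
    (h : ∀ t : ℝ, EvenMomentRelation (fun ω => f ω + t * g ω) μ p) (z : ℂ) :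
    EvenMomentRelation (fun ω => f ω + z * g ω) μ p := by
  have key : Polynomial.C (2 ^ p * p.factorial : ℂ) * momentPolynomial f g μ (2 * p) =
      Polynomial.C ((2 * p).factorial : ℂ) * momentPolynomial f g μ 2 ^ p := by
    refine Polynomial.eq_of_infinite_eval_eq _ _ ?_
    refine (Set.infinite_range_of_injective Complex.ofReal_injective).mono ?_
    rintro _ ⟨t, rfl⟩
    simpa [eval_momentPolynomial hf hg, EvenMomentRelation] using h t
  simpa [eval_momentPolynomial hf hg, EvenMomentRelation] using
    congrArg (Polynomial.eval z) key

end Moments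

theorem gaussian_pair_product_moments {Ω : Type*} [MeasureSpace Ω]
    [IsProbabilityMeasure (ℙ : Measure Ω)] (X Y : Ω → ℂ)
    (hGauss : ∀ t : Fin 4 → ℝ, ∃ v : NNReal,
      Measure.map (fun ω => t 0 * (X ω).re + t 1 * (X ω).im
        + t 2 * (Y ω).re + t 3 * (Y ω).im) ℙ = gaussianReal 0 v)
    (σX σY : ℝ) (σXY : ℂ)
    (hX2 : ∫ ω, (X ω) ^ 2 ∂ℙ = 0) (hY2 : ∫ ω, (Y ω) ^ 2 ∂ℙ = 0)
    (hXX : ∫ ω, ‖X ω‖ ^ 2 ∂ℙ = σX) (hYY : ∫ ω, ‖Y ω‖ ^ 2 ∂ℙ = σY)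
    (hXY : ∫ ω, X ω * Y ω ∂ℙ = σXY)
    (hXcY : ∫ ω, X ω * (starRingEnd ℂ) (Y ω) ∂ℙ = 0)
    (p : ℕ) (hp : 1 ≤ p) :
    ∫ ω, (X ω * Y ω) ^ p ∂ℙ = (p.factorial : ℂ) * σXY ^ p := by
  have hXre : HasFiniteMoments (fun ω => ((X ω).re : ℂ)) ℙ := by
    obtain ⟨v, hv⟩ := hGauss ![1, 0, 0, 0]
    exact hasFiniteMoments_ofReal_of_map_eq_gaussianReal (v := v) (by simpa using hv)
  have hXim : HasFiniteMoments (fun ω => ((X ω).im : ℂ)) ℙ := by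
    obtain ⟨v, hv⟩ := hGauss ![0, 1, 0, 0]
    exact hasFiniteMoments_ofReal_of_map_eq_gaussianReal (v := v) (by simpa using hv)
  have hYre : HasFiniteMoments (fun ω => ((Y ω).re : ℂ)) ℙ := by
    obtain ⟨v, hv⟩ := hGauss ![0, 0, 1, 0]
    exact hasFiniteMoments_ofReal_of_map_eq_gaussianReal (v := v) (by simpa using hv)
  have hYim : HasFiniteMoments (fun ω => ((Y ω).im : ℂ)) ℙ := by
    obtain ⟨v, hv⟩ := hGauss ![0, 0, 0, 1]
    exact hasFiniteMoments_ofReal_of_map_eq_gaussianReal (v := v) (by simpa using hv)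
  have hX : HasFiniteMoments X ℙ := by
    have h := hXre.add (hXim.const_mul Complex.I)
    simpa only [mul_comm Complex.I, Complex.re_add_im] using h
  have hY : HasFiniteMoments Y ℙ := by
    have h := hYre.add (hYim.const_mul Complex.I)
    simpa only [mul_comm Complex.I, Complex.re_add_im] using h
  have h_real (a b c : ℝ) : EvenMomentRelation (fun ω => ((X ω).re : ℂ) + a * (X ω).im +
      b * (Y ω).re + c * (Y ω).im) ℙ p := by
    obtain ⟨v, hv⟩ := hGauss ![1, a, b, c]
    have h := congrArg (fun x : ℝ => (x : ℂ)) (integral_even_pow_of_map_eq_gaussianReal hv p)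
    simp only [Complex.ofReal_mul, Complex.ofReal_pow, ← integral_complex_ofReal] at h
    simpa [EvenMomentRelation] using h
  have h_complex (a b c : ℂ) : EvenMomentRelation (fun ω => ((X ω).re : ℂ) + a * (X ω).im +
      b * (Y ω).re + c * (Y ω).im) ℙ p := by
    have h1 (a b : ℝ) (c : ℂ) : EvenMomentRelation (fun ω => ((X ω).re : ℂ) + a * (X ω).im +
        b * (Y ω).re + c * (Y ω).im) ℙ p :=
      .of_real ((hXre.add (hXim.const_mul a)).add (hYre.const_mul b)) hYim (h_real a b) c
    have h2 (a : ℝ) (b c : ℂ) : EvenMomentRelation (fun ω => ((X ω).re : ℂ) + a * (X ω).im +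
        b * (Y ω).re + c * (Y ω).im) ℙ p := by
      have := EvenMomentRelation.of_real (p := p)
        ((hXre.add (hXim.const_mul a)).add (hYim.const_mul c)) hYre
        (fun t => by simpa only [add_right_comm] using h1 a t c) b
      simpa only [add_right_comm] using this
    have := EvenMomentRelation.of_real (p := p)
      ((hXre.add (hYre.const_mul b)).add (hYim.const_mul c)) hXim
      (fun t => by
        convert h2 t b c using 2
        ring) a
    convert this using 2
    ring
  have h_pencil (s : ℂ) : EvenMomentRelation (fun ω => X ω + s * Y ω) ℙ p := by
    convert h_complex Complex.I s (s * Complex.I) using 2 with ω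
    linear_combination -(Complex.re_add_im (X ω)) - s * Complex.re_add_im (Y ω)
  have h_two : momentPolynomial X Y ℙ 2 = Polynomial.C (2 * σXY) * Polynomial.X := by
    simp [momentPolynomial, Finset.sum_range_succ, hX2, hY2, hXY]
    exact .inl (map_ofNat Polynomial.C 2).symm
  have key : Polynomial.C (2 ^ p * p.factorial : ℂ) * momentPolynomial X Y ℙ (2 * p) =
      Polynomial.C ((2 * p).factorial * (2 * σXY) ^ p) * Polynomial.X ^ p := by
    refine Polynomial.funext fun s => ?_
    have h := h_pencil s
    rw [EvenMomentRelation, ← eval_momentPolynomial hX hY, ← eval_momentPolynomial hX hY,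
      h_two] at h
    simpa [mul_pow, mul_assoc] using h
  have h_coeff := congrArg (fun q => Polynomial.coeff q p) key
  simp only [Polynomial.coeff_C_mul, Polynomial.coeff_X_pow_self, mul_one] at h_coeff
  rw [coeff_momentPolynomial _ _ (by omega), show 2 * p - p = p by omega] at h_coeff
  simp only [← mul_pow] at h_coeff
  have h_choose : ((2 * p).choose p : ℂ) * p.factorial * p.factorial = (2 * p).factorial := by
    have h := Nat.choose_mul_factorial_mul_factorial (show p ≤ 2 * p by omega)
    rw [show 2 * p - p = p by omega] at h
    exact_mod_cast h
  have h_ne : (2 ^ p * p.factorial * (2 * p).choose p : ℂ) ≠ 0 := by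
    have := (Nat.choose_pos (show p ≤ 2 * p by omega)).ne'
    exact_mod_cast mul_ne_zero (mul_ne_zero (by positivity) p.factorial_ne_zero) this
  refine mul_left_cancel₀ h_ne ?_
  rw [← h_choose, mul_pow] at h_coeff
  linear_combination h_coeff
end

section
/- Let V be Haar-distributed on the unitary group U(N) with N ≥ 2, and let A, B, C, D be deterministic N×N complex matrices. Then E[ Tr(A V B V*) · Tr(C V D V*) ] = (1/(N²-1))·( Tr(A)Tr(C)Tr(B)Tr(D) + Tr(AC)Tr(BD) ) − (1/(N(N²-1)))·( Tr(A)Tr(C)Tr(BD) + Tr(AC)Tr(B)Tr(D) ). -/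
open MeasureTheory Matrix

section InvariantTensor

variable {n : Type*} [Fintype n] [DecidableEq n]

/-- Conjugation invariance of a four-index tensor: `G` is unchanged when the matrices whose
entries are indexed by `(i, j)` and `(k, l)` are both conjugated by a unitary matrix. -/
def IsUnitarilyInvariant (G : n → n → n → n → ℂ) : Prop :=
  ∀ U ∈ Matrix.unitaryGroup n ℂ, ∀ i j k l,
    G i j k l = ∑ a, ∑ b, ∑ c, ∑ d, U i a * star (U j b) * (U k c * star (U l d)) * G a b c d

namespace IsUnitarilyInvariant

variable {G : n → n → n → n → ℂ}

theorem diagonal_smul (hG : IsUnitarilyInvariant G) (d : n → ℂ) (hd : ∀ i, d i * star (d i) = 1)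
    (i j k l : n) : G i j k l = d i * star (d j) * (d k * star (d l)) * G i j k l := by
  have hU : diagonal d ∈ Matrix.unitaryGroup n ℂ := by
    rw [mem_unitaryGroup_iff, star_eq_conjTranspose, diagonal_conjTranspose, diagonal_mul_diagonal,
      ← diagonal_one]
    congr 1
    funext i
    exact hd i
  conv_lhs => rw [hG _ hU i j k l]
  simp [diagonal_apply, apply_ite, ite_mul, Finset.sum_ite_eq]

theorem perm_apply (hG : IsUnitarilyInvariant G) (σ : Equiv.Perm n) (i j k l : n) :
    G (σ i) (σ j) (σ k) (σ l) = G i j k l := by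
  have hU : (Matrix.of fun i a => if σ i = a then 1 else 0 : Matrix n n ℂ) ∈
      Matrix.unitaryGroup n ℂ := by
    rw [mem_unitaryGroup_iff, star_eq_conjTranspose]
    ext i j
    simp [mul_apply, one_apply, apply_ite, eq_comm]
  rw [hG _ hU i j k l]
  simp [apply_ite, ite_mul, Finset.sum_ite_eq]

theorem eq_zero_of_left (hG : IsUnitarilyInvariant G) {i j k l : n} (hj : i ≠ j) (hl : i ≠ l) :
    G i j k l = 0 := by
  have h := hG.diagonal_smul (fun m => if m = i then Complex.I else 1)
    (fun m => by by_cases hm : m = i <;> simp [hm]) i j k l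
  simp only [if_true, if_neg hj.symm, if_neg hl.symm, star_one, mul_one] at h
  split_ifs at h
  · rw [Complex.I_mul_I] at h
    linear_combination h / 2
  · have h2 : (1 - Complex.I) * G i j k l = 0 := by linear_combination h
    refine (mul_eq_zero.1 h2).resolve_left fun h3 => ?_
    simpa using congrArg Complex.re h3

theorem eq_zero_of_right (hG : IsUnitarilyInvariant G) {i j k l : n} (hj : k ≠ j) (hl : k ≠ l) :
    G i j k l = 0 := by
  have h := hG.diagonal_smul (fun m => if m = k then Complex.I else 1)
    (fun m => by by_cases hm : m = k <;> simp [hm]) i j k l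
  simp only [if_true, if_neg hj.symm, if_neg hl.symm, star_one, mul_one] at h
  split_ifs at h
  · rw [Complex.I_mul_I] at h
    linear_combination h / 2
  · have h2 : (1 - Complex.I) * G i j k l = 0 := by linear_combination h
    refine (mul_eq_zero.1 h2).resolve_left fun h3 => ?_
    simpa using congrArg Complex.re h3

theorem eq_zero_of_single_ne (hG : IsUnitarilyInvariant G) {i l : n} (hl : l ≠ i) :
    G i i i l = 0 ∧ G i l i i = 0 ∧ G i l i l = 0 ∧ G i l l l = 0 := by
  have key (j k m : n) := hG.diagonal_smul (fun m => if m = i then Complex.I else 1)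
    (fun m => by by_cases hm : m = i <;> simp [hm]) i j k m
  have hc {z w : ℂ} (h : w = z * w) (hz : z.re ≠ 1) : w = 0 := by
    have h2 : (1 - z) * w = 0 := by linear_combination h
    refine (mul_eq_zero.1 h2).resolve_left fun h3 => hz ?_
    simpa using (congrArg Complex.re (sub_eq_zero.1 h3)).symm
  refine ⟨hc (key i i l) ?_, hc (key l i i) ?_, hc (key l i l) ?_, hc (key l l l) ?_⟩ <;>
    (simp [hl]; try norm_num)

theorem diag_eq_add (hG : IsUnitarilyInvariant G) {i k : n} (hik : i ≠ k) :
    G i i i i = G i i k k + G i k k i := by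
  set v : n → ℂ := Pi.single i 1 - 2 • Pi.single k 1 with hv
  have hsv : star v = v := by
    funext m
    simp only [hv, Pi.star_apply, Pi.sub_apply, Pi.smul_apply, Pi.single_apply]
    split_ifs <;> simp
  have hvv : v ⬝ᵥ v = 5 := by
    simp only [hv, sub_dotProduct, dotProduct_sub, smul_dotProduct, dotProduct_smul,
      single_dotProduct, Pi.single_eq_same, Pi.single_eq_of_ne hik, Pi.single_eq_of_ne hik.symm]
    norm_num
  have hU : (1 - (2 / 5 : ℂ) • vecMulVec v v) ∈ Matrix.unitaryGroup n ℂ := by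
    have hstar : star (1 - (2 / 5 : ℂ) • vecMulVec v v) = 1 - (2 / 5 : ℂ) • vecMulVec v v := by
      rw [star_eq_conjTranspose, conjTranspose_sub, conjTranspose_smul, conjTranspose_vecMulVec,
        hsv, conjTranspose_one]
      simp
    have hsq : vecMulVec v v * vecMulVec v v = (5 : ℂ) • vecMulVec v v := by
      rw [vecMulVec_mul_vecMulVec, hvv, vecMulVec_smul]
    rw [mem_unitaryGroup_iff, hstar, mul_sub, sub_mul, sub_mul, smul_mul_smul_comm, hsq]
    simp only [mul_one, one_mul]
    module
  have hrow (a : n) : (1 - (2 / 5 : ℂ) • vecMulVec v v) i a =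
      (if i = a then 3 / 5 else 0) + (if k = a then 4 / 5 else 0) := by
    by_cases h1 : i = a
    · subst h1
      simp [hv, vecMulVec_apply, hik, hik.symm]
      norm_num
    · by_cases h2 : k = a
      · subst h2
        simp [hv, vecMulVec_apply, hik, hik.symm]
        norm_num
      · simp [hv, vecMulVec_apply, hik, h1, h2, Ne.symm h1, Ne.symm h2]
  have h := hG _ hU i i i i
  simp only [hrow, star_add, apply_ite star, star_zero, add_mul, mul_add, Finset.sum_add_distrib,
    ite_mul, mul_ite, zero_mul, mul_zero, Finset.sum_ite_eq, Finset.mem_univ, if_true] at h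
  have h3 : star (3 / 5 : ℂ) = 3 / 5 := by simp
  have h4 : star (4 / 5 : ℂ) = 4 / 5 := by simp
  have hki := hik.symm
  have hswap (a b c d : n) := hG.perm_apply (Equiv.swap i k) a b c d
  have e1 := hswap i i i i
  have e2 := hswap i i k k
  have e3 := hswap i k k i
  simp only [Equiv.swap_apply_left, Equiv.swap_apply_right] at e1 e2 e3
  obtain ⟨z1, z2, z3, z4⟩ := hG.eq_zero_of_single_ne hki
  obtain ⟨w1, w2, w3, w4⟩ := hG.eq_zero_of_single_ne hik
  rw [h3, h4, e1, e2, e3, z1, z2, z3, z4, w1, w2, w3, w4] at h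
  have z5 := hG.eq_zero_of_right (i := i) (k := k) (j := i) (l := i) hki hki
  have w5 := hG.eq_zero_of_right (i := k) (k := i) (j := k) (l := k) hik hik
  linear_combination (625 / 288) * h + (3 / 8) * z5 + (2 / 3) * w5

/-- A conjugation-invariant four-index tensor is a combination of the two contractions. -/
theorem exists_eq (hG : IsUnitarilyInvariant G) [Nontrivial n] :
    ∃ α β : ℂ, ∀ i j k l, G i j k l =
      α * ((1 : Matrix n n ℂ) i j * (1 : Matrix n n ℂ) k l) +
      β * ((1 : Matrix n n ℂ) i l * (1 : Matrix n n ℂ) k j) := by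
  obtain ⟨p, q, hpq⟩ := exists_pair_ne n
  have hmove {i k : n} (hik : i ≠ k) : ∃ σ : Equiv.Perm n, σ p = i ∧ σ q = k :=
    MulAction.is_two_pretransitive_iff.1 (Equiv.Perm.isMultiplyPretransitive n 2) hpq hik
  have ha {i k : n} (hik : i ≠ k) : G i i k k = G p p q q := by
    obtain ⟨σ, rfl, rfl⟩ := hmove hik
    exact hG.perm_apply σ _ _ _ _
  have hb {i k : n} (hik : i ≠ k) : G i k k i = G p q q p := by
    obtain ⟨σ, rfl, rfl⟩ := hmove hik
    exact hG.perm_apply σ _ _ _ _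
  refine ⟨G p p q q, G p q q p, fun i j k l => ?_⟩
  by_cases hij : i = j
  · subst hij
    by_cases hkl : k = l
    · subst hkl
      by_cases hik : i = k
      · subst hik
        obtain ⟨m, hm⟩ := exists_ne i
        rw [hG.diag_eq_add hm.symm, ha hm.symm, hb hm.symm]
        simp
      · rw [ha hik]
        simp [hik]
    · by_cases hik : i = k
      · subst hik
        rw [(hG.eq_zero_of_single_ne (Ne.symm hkl)).1]
        simp [hkl]
      · rw [hG.eq_zero_of_right (Ne.symm hik) hkl]
        simp [hkl, Ne.symm hik]
  · by_cases hil : i = l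
    · subst hil
      by_cases hkj : k = j
      · subst hkj
        rw [hb hij]
        simp [hij]
      · by_cases hki : k = i
        · subst hki
          rw [(hG.eq_zero_of_single_ne (Ne.symm hij)).2.1]
          simp [hij]
        · rw [hG.eq_zero_of_right hkj hki]
          simp [hij, hkj]
    · rw [hG.eq_zero_of_left hij hil]
      simp [hij, hil]

end IsUnitarilyInvariant

end InvariantTensor

section Haar

variable {n : Type*} [Fintype n] [DecidableEq n]

theorem isCompact_unitaryGroup : IsCompact (Matrix.unitaryGroup n ℂ : Set (Matrix n n ℂ)) := by
  have hK : IsCompact (Set.univ.pi fun _ => Set.univ.pi fun _ => Metric.closedBall 0 1 :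
      Set (Matrix n n ℂ)) :=
    isCompact_univ_pi fun _ => isCompact_univ_pi fun _ => isCompact_closedBall _ _
  refine hK.of_isClosed_subset ?_ fun U hU i _ j _ => ?_
  · have : (Matrix.unitaryGroup n ℂ : Set (Matrix n n ℂ)) = {U | U * star U = 1} := by
      ext U
      exact mem_unitaryGroup_iff
    rw [this]
    exact isClosed_eq (by fun_prop) continuous_const
  · simpa using entry_norm_bound_of_unitary hU i j

/-- Conjugation of `B` by a unitary matrix. -/
def unitaryConj (B : Matrix n n ℂ) (V : Matrix.unitaryGroup n ℂ) : Matrix n n ℂ :=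
  (V : Matrix n n ℂ) * B * (V : Matrix n n ℂ)ᴴ

theorem continuous_unitaryConj_apply (B : Matrix n n ℂ) (i j : n) :
    Continuous fun V => unitaryConj B V i j := by
  have h : Continuous (unitaryConj B) := by
    unfold unitaryConj
    fun_prop
  exact (continuous_apply j).comp ((continuous_apply i).comp h)

theorem unitaryConj_mul_apply (B : Matrix n n ℂ) (U V : Matrix.unitaryGroup n ℂ) (i j : n) :
    unitaryConj B (U * V) i j = ∑ a, ∑ b, U.1 i a * star (U.1 j b) * unitaryConj B V a b := by
  have : unitaryConj B (U * V) = U.1 * unitaryConj B V * U.1ᴴ := by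
    simp [unitaryConj, conjTranspose_mul, Matrix.mul_assoc]
  rw [this, mul_apply, Finset.sum_comm]
  refine Finset.sum_congr rfl fun b _ => ?_
  rw [mul_apply, Finset.sum_mul]
  refine Finset.sum_congr rfl fun a _ => ?_
  rw [conjTranspose_apply]
  ring

theorem trace_unitaryConj (B : Matrix n n ℂ) (V : Matrix.unitaryGroup n ℂ) :
    (unitaryConj B V).trace = B.trace := by
  rw [unitaryConj, trace_mul_cycle, ← star_eq_conjTranspose, UnitaryGroup.star_mul_self,
    Matrix.one_mul]

theorem unitaryConj_mul_unitaryConj (B D : Matrix n n ℂ) (V : Matrix.unitaryGroup n ℂ) :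
    unitaryConj B V * unitaryConj D V = unitaryConj (B * D) V := by
  have h : (V : Matrix n n ℂ)ᴴ * (V : Matrix n n ℂ) = 1 := UnitaryGroup.star_mul_self V
  calc unitaryConj B V * unitaryConj D V
      = V.1 * B * (V.1ᴴ * V.1) * D * V.1ᴴ := by simp only [unitaryConj, Matrix.mul_assoc]
    _ = unitaryConj (B * D) V := by rw [h]; simp only [unitaryConj, Matrix.mul_assoc, Matrix.one_mul]

theorem trace_mul_unitaryConj_mul (A B C D : Matrix n n ℂ) (V : Matrix.unitaryGroup n ℂ) :
    (A * unitaryConj B V).trace * (C * unitaryConj D V).trace =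
      ∑ i, ∑ k, ∑ j, ∑ l, A i j * C k l * (unitaryConj B V j i * unitaryConj D V l k) := by
  simp only [trace, diag_apply, mul_apply, Finset.sum_mul_sum]
  refine Finset.sum_congr rfl fun a _ => Finset.sum_congr rfl fun b _ =>
    Finset.sum_congr rfl fun c _ => Finset.sum_congr rfl fun d _ => ?_
  ring

variable [MeasurableSpace (Matrix.unitaryGroup n ℂ)] [BorelSpace (Matrix.unitaryGroup n ℂ)]
  {μ : Measure (Matrix.unitaryGroup n ℂ)} [IsProbabilityMeasure μ]

theorem Continuous.integrable_unitaryGroup {f : Matrix.unitaryGroup n ℂ → ℂ} (hf : Continuous f) :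
    Integrable f μ := by
  have : CompactSpace (Matrix.unitaryGroup n ℂ) := isCompact_iff_compactSpace.1 isCompact_unitaryGroup
  exact hf.integrable_of_hasCompactSupport (HasCompactSupport.of_compactSpace f)

theorem integrable_const_mul_unitaryConj (B D : Matrix n n ℂ) (c : ℂ) (i j k l : n) :
    Integrable (fun V => c * (unitaryConj B V i j * unitaryConj D V k l)) μ :=
  (continuous_const.mul ((continuous_unitaryConj_apply B i j).mul
    (continuous_unitaryConj_apply D k l))).integrable_unitaryGroup

theorem integral_sum_unitaryConj (B D : Matrix n n ℂ) (w : n → n → n → n → ℂ)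
    (f₁ f₂ f₃ f₄ : n → n → n → n → n) :
    ∫ V, ∑ a, ∑ b, ∑ c, ∑ d, w a b c d * (unitaryConj B V (f₁ a b c d) (f₂ a b c d) *
        unitaryConj D V (f₃ a b c d) (f₄ a b c d)) ∂μ =
      ∑ a, ∑ b, ∑ c, ∑ d, w a b c d * ∫ V, unitaryConj B V (f₁ a b c d) (f₂ a b c d) *
        unitaryConj D V (f₃ a b c d) (f₄ a b c d) ∂μ := by
  have hint (a b c d : n) := integrable_const_mul_unitaryConj (μ := μ) B D (w a b c d)
    (f₁ a b c d) (f₂ a b c d) (f₃ a b c d) (f₄ a b c d)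
  rw [integral_finsetSum _ fun a _ => integrable_finsetSum _ fun b _ =>
    integrable_finsetSum _ fun c _ => integrable_finsetSum _ fun d _ => hint a b c d]
  refine Finset.sum_congr rfl fun a _ => ?_
  rw [integral_finsetSum _ fun b _ => integrable_finsetSum _ fun c _ =>
    integrable_finsetSum _ fun d _ => hint a b c d]
  refine Finset.sum_congr rfl fun b _ => ?_
  rw [integral_finsetSum _ fun c _ => integrable_finsetSum _ fun d _ => hint a b c d]
  refine Finset.sum_congr rfl fun c _ => ?_
  rw [integral_finsetSum _ fun d _ => hint a b c d]
  exact Finset.sum_congr rfl fun d _ => integral_const_mul _ _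

theorem isUnitarilyInvariant_integral (hinv : ∀ U, Measure.map (fun V => U * V) μ = μ)
    (B D : Matrix n n ℂ) :
    IsUnitarilyInvariant fun i j k l => ∫ V, unitaryConj B V i j * unitaryConj D V k l ∂μ := by
  intro U hU i j k l
  have hmeas : Measurable fun V => (⟨U, hU⟩ : Matrix.unitaryGroup n ℂ) * V :=
    (continuous_const.mul continuous_id).measurable
  have hexp (V : Matrix.unitaryGroup n ℂ) :
      unitaryConj B (⟨U, hU⟩ * V) i j * unitaryConj D (⟨U, hU⟩ * V) k l =
        ∑ a, ∑ b, ∑ c, ∑ d, U i a * star (U j b) * (U k c * star (U l d)) *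
          (unitaryConj B V a b * unitaryConj D V c d) := by
    simp only [unitaryConj_mul_apply, Finset.sum_mul]
    simp only [Finset.mul_sum]
    refine Finset.sum_congr rfl fun a _ => Finset.sum_congr rfl fun b _ =>
      Finset.sum_congr rfl fun c _ => Finset.sum_congr rfl fun d _ => ?_
    ring
  calc ∫ V, unitaryConj B V i j * unitaryConj D V k l ∂μ
      = ∫ V, unitaryConj B V i j * unitaryConj D V k l
          ∂(Measure.map (fun V => (⟨U, hU⟩ : Matrix.unitaryGroup n ℂ) * V) μ) := by rw [hinv]
    _ = ∫ V, unitaryConj B (⟨U, hU⟩ * V) i j * unitaryConj D (⟨U, hU⟩ * V) k l ∂μ :=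
      integral_map hmeas.aemeasurable ((continuous_unitaryConj_apply B i j).mul
        (continuous_unitaryConj_apply D k l)).aestronglyMeasurable
    _ = _ := by
      simp only [hexp]
      exact integral_sum_unitaryConj B D _ (fun a _ _ _ => a) (fun _ b _ _ => b)
        (fun _ _ c _ => c) (fun _ _ _ d => d)

theorem integral_trace_mul_trace {B D : Matrix n n ℂ} {α β : ℂ}
    (h : ∀ i j k l, ∫ V, unitaryConj B V i j * unitaryConj D V k l ∂μ =
      α * ((1 : Matrix n n ℂ) i j * (1 : Matrix n n ℂ) k l) +
      β * ((1 : Matrix n n ℂ) i l * (1 : Matrix n n ℂ) k j)) (A C : Matrix n n ℂ) :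
    ∫ V, (A * unitaryConj B V).trace * (C * unitaryConj D V).trace ∂μ =
      α * (A.trace * C.trace) + β * (A * C).trace := by
  simp only [trace_mul_unitaryConj_mul]
  rw [integral_sum_unitaryConj B D _ (fun _ _ j _ => j) (fun i _ _ _ => i)
    (fun _ _ _ l => l) (fun _ k _ _ => k)]
  simp only [h, mul_add, Finset.sum_add_distrib]
  congr 1
  · simp [one_apply, trace, ← Finset.sum_mul, ← Finset.mul_sum, mul_comm α]
  · simp [one_apply, trace, mul_apply, ← Finset.sum_mul, mul_comm β]

theorem integral_trace_unitaryConj_mul {B D : Matrix n n ℂ} {α β : ℂ}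
    (h : ∀ i j k l, ∫ V, unitaryConj B V i j * unitaryConj D V k l ∂μ =
      α * ((1 : Matrix n n ℂ) i j * (1 : Matrix n n ℂ) k l) +
      β * ((1 : Matrix n n ℂ) i l * (1 : Matrix n n ℂ) k j)) :
    ∫ V, (unitaryConj B V * unitaryConj D V).trace ∂μ =
      α * Fintype.card n + β * (Fintype.card n : ℂ) ^ 2 := by
  have hint (i j : n) : Integrable (fun V => unitaryConj B V i j * unitaryConj D V j i) μ := by
    simpa using integrable_const_mul_unitaryConj (μ := μ) B D 1 i j j i
  simp only [trace, diag_apply, mul_apply]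
  rw [integral_finsetSum _ fun i _ => integrable_finsetSum _ fun j _ => hint i j]
  simp only [integral_finsetSum _ fun j _ => hint _ j, h, Finset.sum_add_distrib]
  simp [one_apply]
  ring

end Haar

theorem haar_unitary_two_trace_moment (N : ℕ) (hN : 2 ≤ N)
    [MeasurableSpace (Matrix.unitaryGroup (Fin N) ℂ)]
    [BorelSpace (Matrix.unitaryGroup (Fin N) ℂ)]
    (μ : Measure (Matrix.unitaryGroup (Fin N) ℂ)) [IsProbabilityMeasure μ]
    (hinv : ∀ U : Matrix.unitaryGroup (Fin N) ℂ,
      Measure.map (fun V => U * V) μ = μ)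
    (A B C D : Matrix (Fin N) (Fin N) ℂ) :
    ∫ V, (A * (V : Matrix (Fin N) (Fin N) ℂ) * B * (V : Matrix (Fin N) (Fin N) ℂ)ᴴ).trace
        * (C * (V : Matrix (Fin N) (Fin N) ℂ) * D * (V : Matrix (Fin N) (Fin N) ℂ)ᴴ).trace ∂μ
      = (1 / ((N : ℂ) ^ 2 - 1))
          * (A.trace * C.trace * B.trace * D.trace + (A * C).trace * (B * D).trace)
        - (1 / ((N : ℂ) * ((N : ℂ) ^ 2 - 1)))
          * (A.trace * C.trace * (B * D).trace + (A * C).trace * B.trace * D.trace) := by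
  have : Nontrivial (Fin N) := Fin.nontrivial_iff_two_le.2 hN
  obtain ⟨α, β, h⟩ := (isUnitarilyInvariant_integral hinv B D).exists_eq
  have h1 := integral_trace_mul_trace h 1 1
  have h2 := integral_trace_unitaryConj_mul h
  simp only [unitaryConj_mul_unitaryConj, Matrix.one_mul, trace_unitaryConj, integral_const,
    probReal_univ, one_smul, trace_one, Fintype.card_fin] at h1 h2
  have hassoc (A B : Matrix (Fin N) (Fin N) ℂ) (V : Matrix.unitaryGroup (Fin N) ℂ) :
      A * (V : Matrix (Fin N) (Fin N) ℂ) * B * (V : Matrix (Fin N) (Fin N) ℂ)ᴴ =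
        A * unitaryConj B V := by
    simp only [unitaryConj, Matrix.mul_assoc]
  simp only [hassoc]
  rw [integral_trace_mul_trace h]
  have hN0 : (N : ℂ) ≠ 0 := by
    norm_cast
    omega
  have hN1 : (N : ℂ) ^ 2 - 1 ≠ 0 := by
    rw [sub_ne_zero]
    norm_cast
    nlinarith
  have hα : (N : ℂ) * ((N : ℂ) ^ 2 - 1) * α = N * (B.trace * D.trace) - (B * D).trace := by
    linear_combination -(N : ℂ) * h1 + h2
  have hβ : (N : ℂ) * ((N : ℂ) ^ 2 - 1) * β = N * (B * D).trace - B.trace * D.trace := by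
    linear_combination -(N : ℂ) * h2 + h1
  field_simp
  linear_combination (A.trace * C.trace) * hα + (A * C).trace * hβ
end

section
/- Let V be Haar-distributed on U(N), N ≥ 2, and A, B, C, D deterministic N×N complex matrices. Then E[ Tr(A V B V* C V D V*) ] = (1/(N²-1))·( Tr(AC)Tr(B)Tr(D) + Tr(A)Tr(C)Tr(BD) ) − (1/(N(N²-1)))·( Tr(AC)Tr(BD) + Tr(A)Tr(C)Tr(B)Tr(D) ). -/
open MeasureTheory Matrix

section UnitaryMoments

variable {n : Type*} [Fintype n] [DecidableEq n]

/-- A four-index tensor fixed by `U ⊗ U* ⊗ U ⊗ U*` for every unitary `U`. -/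
def IsUnitaryInvariant (T : n → n → n → n → ℂ) : Prop :=
  ∀ U ∈ unitaryGroup n ℂ, ∀ i j k l, T i j k l =
    ∑ a, ∑ b, ∑ c, ∑ d, U i a * star (U j b) * U k c * star (U l d) * T a b c d

/-- The reflection sending `e_p` to `3/5 e_p - 4/5 e_q`. -/
noncomputable def planeReflection (p q : n) : Matrix n n ℂ :=
  1 - (2 / 5 : ℂ) • vecMulVec (Pi.single p 1 + Pi.single q 2) (Pi.single p 1 + Pi.single q 2)

lemma planeReflection_mem_unitaryGroup {p q : n} (h : p ≠ q) :
    planeReflection p q ∈ unitaryGroup n ℂ := by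
  rw [mem_unitaryGroup_iff, star_eq_conjTranspose]
  set w : n → ℂ := Pi.single p 1 + Pi.single q 2 with hw
  have hstar : star w = w := by
    simp [hw, star_add]
  have hdot : w ⬝ᵥ w = 5 := by
    simp [hw, h, h.symm]; norm_num
  have hT : (planeReflection p q)ᴴ = planeReflection p q := by
    simp [planeReflection, conjTranspose_vecMulVec, ← hw, hstar]
  rw [hT, planeReflection, ← hw]
  simp only [sub_mul, mul_sub, one_mul, mul_one, smul_mul_assoc, mul_smul_comm,
    vecMulVec_mul_vecMulVec, hdot, vecMulVec_smul, smul_smul]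
  module

omit [Fintype n] in
lemma planeReflection_apply_left {p q : n} (h : p ≠ q) (a : n) :
    planeReflection p q p a = (if a = p then 3 / 5 else 0) - (if a = q then 4 / 5 else 0) := by
  by_cases hp : a = p
  · subst hp; simp [planeReflection, vecMulVec_apply, h]; norm_num
  · by_cases hq : a = q
    · subst hq; simp [planeReflection, vecMulVec_apply, h, hp]; norm_num
    · simp [planeReflection, vecMulVec_apply, h, hp, hq, Ne.symm hp, one_apply]

lemma permMatrix_mem_unitaryGroup (σ : Equiv.Perm n) : σ.permMatrix ℂ ∈ unitaryGroup n ℂ := by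
  rw [mem_unitaryGroup_iff, star_eq_conjTranspose, conjTranspose_permMatrix, ← permMatrix_mul]
  simp

namespace IsUnitaryInvariant

variable {T : n → n → n → n → ℂ}

lemma apply_perm (hT : IsUnitaryInvariant T) (σ : Equiv.Perm n) (i j k l : n) :
    T i j k l = T (σ i) (σ j) (σ k) (σ l) := by
  rw [hT _ (permMatrix_mem_unitaryGroup σ) i j k l]
  simp [Equiv.Perm.permMatrix, PEquiv.toMatrix_apply]

lemma apply_diagonal (hT : IsUnitaryInvariant T) (u : n → ℂ) (hu : ∀ x, u x * star (u x) = 1)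
    (i j k l : n) : T i j k l = u i * star (u j) * u k * star (u l) * T i j k l := by
  have hmem : diagonal u ∈ unitaryGroup n ℂ := by
    rw [mem_unitaryGroup_iff, star_eq_conjTranspose, diagonal_conjTranspose, diagonal_mul_diagonal]
    simp only [Pi.star_apply, hu, diagonal_one]
  conv_lhs => rw [hT _ hmem i j k l]
  simp [diagonal_apply, apply_ite]

lemma eq_zero (hT : IsUnitaryInvariant T) {i j k l : n}
    (h₁ : ¬ (i = j ∧ k = l)) (h₂ : ¬ (i = l ∧ j = k)) : T i j k l = 0 := by
  by_contra h₀
  let u (p x : n) : ℂ := if x = p then Complex.I else 1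
  have hu (p x : n) : u p x * star (u p x) = 1 := by by_cases hx : x = p <;> simp [u, hx]
  have key (p : n) : u p i * star (u p j) * u p k * star (u p l) = 1 :=
    (right_eq_mul₀ h₀).mp (hT.apply_diagonal (u p) (hu p) i j k l)
  by_cases hij : i = j
  · subst hij
    have hkl : l ≠ k := fun h => h₁ ⟨rfl, h.symm⟩
    have hk := key k
    rw [hu] at hk
    simp [u, hkl, Complex.ext_iff] at hk
  · by_cases hil : i = l
    · subst hil
      have hjk : j ≠ k := fun h => h₂ ⟨rfl, h⟩
      have hk := key k
      rw [show ∀ a b c d : ℂ, a * b * c * d = a * d * b * c by intros; ring, hu] at hk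
      simp [u, hjk, Complex.ext_iff] at hk
    · have hi := key i
      by_cases hik : k = i
      · simp [u, hik, Ne.symm hij, Ne.symm hil, Complex.ext_iff] at hi
        norm_num at hi
      · simp [u, hik, Ne.symm hij, Ne.symm hil, Complex.ext_iff] at hi

lemma apply_self (hT : IsUnitaryInvariant T) {p q : n} (h : p ≠ q) :
    T p p p p = T p p q q + T p q q p := by
  have hR := hT _ (planeReflection_mem_unitaryGroup h) p p p p
  have e₁ : T q q q q = T p p p p := by simpa using hT.apply_perm (Equiv.swap p q) q q q q
  have e₂ : T q q p p = T p p q q := by simpa using hT.apply_perm (Equiv.swap p q) q q p p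
  have e₃ : T q p p q = T p q q p := by simpa using hT.apply_perm (Equiv.swap p q) q p p q
  have z {i j k l : n} := hT.eq_zero (i := i) (j := j) (k := k) (l := l)
  simp only [planeReflection_apply_left h, star_sub, apply_ite star, star_zero, sub_mul, mul_sub,
    Finset.sum_sub_distrib, ite_mul, mul_ite, zero_mul, mul_zero, Finset.sum_ite_eq',
    Finset.mem_univ, if_true, e₁, e₂, e₃] at hR
  simp [z, h, h.symm] at hR
  linear_combination (625 / 288 : ℂ) * hR

lemma exists_form [Nontrivial n] (hT : IsUnitaryInvariant T) :
    ∃ α β : ℂ, ∀ i j k l, T i j k l =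
      α * (if i = j ∧ k = l then 1 else 0) + β * (if i = l ∧ j = k then 1 else 0) := by
  obtain ⟨p, q, hpq⟩ := exists_pair_ne n
  refine ⟨T p p q q, T p q q p, fun i j k l => ?_⟩
  have htrans {i k : n} (h : i ≠ k) : T i i k k = T p p q q ∧ T i k k i = T p q q p := by
    obtain ⟨σ, hp, hq⟩ := MulAction.is_two_pretransitive_iff.mp
      (Equiv.Perm.isMultiplyPretransitive n 2) h hpq
    rw [Equiv.Perm.smul_def] at hp hq
    rw [hT.apply_perm σ i i k k, hT.apply_perm σ i k k i, hp, hq]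
    exact ⟨rfl, rfl⟩
  by_cases h₁ : i = j ∧ k = l
  · obtain ⟨rfl, rfl⟩ := h₁
    by_cases hik : i = k
    · subst hik
      obtain ⟨m, hm⟩ := exists_ne i
      simp [hT.apply_self hm.symm, htrans hm.symm]
    · simp [hik, htrans hik]
  · by_cases h₂ : i = l ∧ j = k
    · obtain ⟨rfl, rfl⟩ := h₂
      have hij : i ≠ j := fun h => h₁ ⟨h, h.symm⟩
      simp [hij, htrans hij]
    · simp [h₁, h₂, hT.eq_zero h₁ h₂]

end IsUnitaryInvariant

instance : CompactSpace (unitaryGroup n ℂ) := by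
  refine isCompact_iff_compactSpace (s := (unitaryGroup n ℂ : Set (Matrix n n ℂ))).mp ?_
  refine IsCompact.of_isClosed_subset
    (isCompact_univ_pi fun _ => isCompact_univ_pi fun _ => isCompact_closedBall (0 : ℂ) 1)
    (isClosed_unitary (R := Matrix n n ℂ)) fun U hU i _ j _ => ?_
  simpa using entry_norm_bound_of_unitary hU i j

omit [DecidableEq n] in
lemma conj_apply (U X : Matrix n n ℂ) (i j : n) :
    (U * X * Uᴴ) i j = ∑ a, ∑ b, U i a * star (U j b) * X a b := by
  simp only [mul_apply, conjTranspose_apply, Finset.sum_mul]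
  rw [Finset.sum_comm]
  exact Finset.sum_congr rfl fun a _ => Finset.sum_congr rfl fun b _ => by ring

/-- The product `(V B V*)_{ij} (V D V*)_{kl}`. -/
noncomputable def conjProd (B D : Matrix n n ℂ) (i j k l : n) (V : unitaryGroup n ℂ) : ℂ :=
  ((V : Matrix n n ℂ) * B * (V : Matrix n n ℂ)ᴴ) i j *
    ((V : Matrix n n ℂ) * D * (V : Matrix n n ℂ)ᴴ) k l

lemma conjProd_mul (B D : Matrix n n ℂ) (i j k l : n) (U V : unitaryGroup n ℂ) :
    conjProd B D i j k l (U * V) = ∑ a, ∑ b, ∑ c, ∑ d,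
      (U : Matrix n n ℂ) i a * star ((U : Matrix n n ℂ) j b) * (U : Matrix n n ℂ) k c *
        star ((U : Matrix n n ℂ) l d) * conjProd B D a b c d V := by
  have hconj (X : Matrix n n ℂ) :
      (U : Matrix n n ℂ) * (V : Matrix n n ℂ) * X * ((U : Matrix n n ℂ) * (V : Matrix n n ℂ))ᴴ =
        U * ((V : Matrix n n ℂ) * X * (V : Matrix n n ℂ)ᴴ) * (U : Matrix n n ℂ)ᴴ := by
    simp only [conjTranspose_mul, Matrix.mul_assoc]
  simp only [conjProd, Submonoid.coe_mul, hconj, conj_apply (U : Matrix n n ℂ)]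
  simp only [Finset.sum_mul]
  simp only [Finset.mul_sum]
  exact Finset.sum_congr rfl fun a _ => Finset.sum_congr rfl fun b _ =>
    Finset.sum_congr rfl fun c _ => Finset.sum_congr rfl fun d _ => by ring

lemma continuous_conjProd (B D : Matrix n n ℂ) (i j k l : n) :
    Continuous (conjProd B D i j k l) := by
  unfold conjProd
  fun_prop

section Haar

variable [MeasurableSpace (unitaryGroup n ℂ)] [BorelSpace (unitaryGroup n ℂ)]
  (μ : Measure (unitaryGroup n ℂ)) [IsFiniteMeasure μ]

lemma integral_sum_conjProd (B D : Matrix n n ℂ) (w : n → n → n → n → ℂ) :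
    ∫ V, ∑ a, ∑ b, ∑ c, ∑ d, w a b c d * conjProd B D a b c d V ∂μ =
      ∑ a, ∑ b, ∑ c, ∑ d, w a b c d * ∫ V, conjProd B D a b c d V ∂μ := by
  have h₁ (a b c d : n) : Integrable (fun V => w a b c d * conjProd B D a b c d V) μ :=
    ((continuous_conjProd B D a b c d).integrable_of_hasCompactSupport
      (HasCompactSupport.of_compactSpace _)).const_mul _
  have h₂ (a b c : n) := integrable_finsetSum Finset.univ fun d _ => h₁ a b c d
  have h₃ (a b : n) := integrable_finsetSum Finset.univ fun c _ => h₂ a b c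
  have h₄ (a : n) := integrable_finsetSum Finset.univ fun b _ => h₃ a b
  rw [integral_finsetSum _ fun a _ => h₄ a]
  refine Finset.sum_congr rfl fun a _ => ?_
  rw [integral_finsetSum _ fun b _ => h₃ a b]
  refine Finset.sum_congr rfl fun b _ => ?_
  rw [integral_finsetSum _ fun c _ => h₂ a b c]
  refine Finset.sum_congr rfl fun c _ => ?_
  rw [integral_finsetSum _ fun d _ => h₁ a b c d]
  exact Finset.sum_congr rfl fun d _ => integral_const_mul _ _

lemma isUnitaryInvariant_integral_conjProd
    (hinv : ∀ U : unitaryGroup n ℂ, Measure.map (fun V => U * V) μ = μ) (B D : Matrix n n ℂ) :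
    IsUnitaryInvariant fun i j k l => ∫ V, conjProd B D i j k l V ∂μ := by
  intro U hU i j k l
  rw [← integral_sum_conjProd μ B D
    fun a b c d => U i a * star (U j b) * U k c * star (U l d)]
  conv_lhs => beta_reduce; rw [← hinv ⟨U, hU⟩]
  rw [integral_map (continuous_const_mul _).aemeasurable
    (continuous_conjProd B D i j k l).aestronglyMeasurable]
  simp only [conjProd_mul]

lemma exists_integral_sum_conjProd [Nontrivial n]
    (hinv : ∀ U : unitaryGroup n ℂ, Measure.map (fun V => U * V) μ = μ) (B D : Matrix n n ℂ) :
    ∃ α β : ℂ, ∀ w : n → n → n → n → ℂ,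
      ∫ V, ∑ a, ∑ b, ∑ c, ∑ d, w a b c d * conjProd B D a b c d V ∂μ =
        α * ∑ a, ∑ c, w a a c c + β * ∑ a, ∑ b, w a b b a := by
  obtain ⟨α, β, h⟩ := (isUnitaryInvariant_integral_conjProd μ hinv B D).exists_form
  refine ⟨α, β, fun w => ?_⟩
  rw [integral_sum_conjProd]
  simp only [h, mul_add, Finset.sum_add_distrib, ite_and, mul_ite, mul_one, mul_zero,
    Finset.sum_ite_eq, Finset.mem_univ, if_true, Finset.mul_sum]
  simp [Finset.sum_ite_irrel, mul_comm]

end Haar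

lemma trace_mul_conj_mul_conj (A B C D : Matrix n n ℂ) (V : unitaryGroup n ℂ) :
    (A * (V : Matrix n n ℂ) * B * (V : Matrix n n ℂ)ᴴ
        * C * (V : Matrix n n ℂ) * D * (V : Matrix n n ℂ)ᴴ).trace =
      ∑ a, ∑ b, ∑ c, ∑ d, A d a * C b c * conjProd B D a b c d V := by
  have h : A * (V : Matrix n n ℂ) * B * (V : Matrix n n ℂ)ᴴ
        * C * (V : Matrix n n ℂ) * D * (V : Matrix n n ℂ)ᴴ =
      A * (((V : Matrix n n ℂ) * B * (V : Matrix n n ℂ)ᴴ) *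
        (C * ((V : Matrix n n ℂ) * D * (V : Matrix n n ℂ)ᴴ))) := by
    simp only [Matrix.mul_assoc]
  rw [h, trace_mul_comm]
  simp only [conjProd]
  generalize (V : Matrix n n ℂ) * B * (V : Matrix n n ℂ)ᴴ = X
  generalize (V : Matrix n n ℂ) * D * (V : Matrix n n ℂ)ᴴ = Y
  simp only [trace, diag_apply, mul_apply, Finset.sum_mul, Finset.mul_sum]
  refine Finset.sum_congr rfl fun a _ => ?_
  rw [Finset.sum_comm]
  refine Finset.sum_congr rfl fun b _ => ?_
  rw [Finset.sum_comm]
  exact Finset.sum_congr rfl fun c _ => Finset.sum_congr rfl fun d _ => by ring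

lemma trace_conj (V : unitaryGroup n ℂ) (X : Matrix n n ℂ) :
    ((V : Matrix n n ℂ) * X * (V : Matrix n n ℂ)ᴴ).trace = X.trace := by
  have hV : (V : Matrix n n ℂ)ᴴ * V = 1 := mem_unitaryGroup_iff'.mp V.2
  rw [trace_mul_cycle, hV, Matrix.one_mul]

lemma trace_mul_trace_eq_sum_conjProd (B D : Matrix n n ℂ) (V : unitaryGroup n ℂ) :
    B.trace * D.trace = ∑ a, ∑ b, ∑ c, ∑ d,
      (1 : Matrix n n ℂ) a b * (1 : Matrix n n ℂ) c d * conjProd B D a b c d V := by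
  rw [← trace_conj V B, ← trace_conj V D]
  simp [conjProd, trace, one_apply, Finset.sum_mul_sum]

lemma trace_mul_eq_sum_conjProd (B D : Matrix n n ℂ) (V : unitaryGroup n ℂ) :
    (B * D).trace = ∑ a, ∑ b, ∑ c, ∑ d,
      (1 : Matrix n n ℂ) d a * (1 : Matrix n n ℂ) b c * conjProd B D a b c d V := by
  have hV : (V : Matrix n n ℂ)ᴴ * V = 1 := mem_unitaryGroup_iff'.mp V.2
  rw [← trace_mul_conj_mul_conj, ← trace_conj V (B * D)]
  congr 1
  simp only [Matrix.one_mul, Matrix.mul_one, Matrix.mul_assoc]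
  rw [← Matrix.mul_assoc _ (V : Matrix n n ℂ), hV, Matrix.one_mul]

end UnitaryMoments

theorem haar_unitary_single_trace_moment (N : ℕ) (hN : 2 ≤ N)
    [MeasurableSpace (Matrix.unitaryGroup (Fin N) ℂ)]
    [BorelSpace (Matrix.unitaryGroup (Fin N) ℂ)]
    (μ : Measure (Matrix.unitaryGroup (Fin N) ℂ)) [IsProbabilityMeasure μ]
    (hinv : ∀ U : Matrix.unitaryGroup (Fin N) ℂ,
      Measure.map (fun V => U * V) μ = μ)
    (A B C D : Matrix (Fin N) (Fin N) ℂ) :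
    ∫ V, (A * (V : Matrix (Fin N) (Fin N) ℂ) * B * (V : Matrix (Fin N) (Fin N) ℂ)ᴴ
        * C * (V : Matrix (Fin N) (Fin N) ℂ) * D * (V : Matrix (Fin N) (Fin N) ℂ)ᴴ).trace ∂μ
      = (1 / ((N : ℂ) ^ 2 - 1))
          * ((A * C).trace * B.trace * D.trace + A.trace * C.trace * (B * D).trace)
        - (1 / ((N : ℂ) * ((N : ℂ) ^ 2 - 1)))
          * ((A * C).trace * (B * D).trace + A.trace * C.trace * B.trace * D.trace) := by
  have : Nontrivial (Fin N) := Fin.nontrivial_iff_two_le.mpr hN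
  obtain ⟨α, β, h⟩ := exists_integral_sum_conjProd μ hinv B D
  have h₁ : B.trace * D.trace = α * N ^ 2 + β * N := by
    have := h fun a b c d => (1 : Matrix (Fin N) (Fin N) ℂ) a b * (1 : Matrix _ _ ℂ) c d
    simp only [← trace_mul_trace_eq_sum_conjProd] at this
    simpa [one_apply, sq] using this
  have h₂ : (B * D).trace = α * N + β * N ^ 2 := by
    have := h fun a b c d => (1 : Matrix (Fin N) (Fin N) ℂ) d a * (1 : Matrix _ _ ℂ) b c
    simp only [← trace_mul_eq_sum_conjProd] at this
    simpa [one_apply, sq] using this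
  have h₃ : ∑ a, ∑ c, A c a * C a c = (A * C).trace := by
    rw [Finset.sum_comm]; rfl
  have h₄ : ∑ a, ∑ b, A a a * C b b = A.trace * C.trace := by
    simp [trace, Finset.sum_mul_sum]
  simp only [trace_mul_conj_mul_conj, h fun a b c d => A d a * C b c, h₃, h₄]
  have hN₀ : (N : ℂ) ≠ 0 := by norm_cast; omega
  have hN₁ : (N : ℂ) ^ 2 - 1 ≠ 0 := by
    rw [sub_ne_zero]
    norm_cast
    nlinarith
  field_simp
  linear_combination (-(N * (A * C).trace) + A.trace * C.trace) * h₁ +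
    ((A * C).trace - N * A.trace * C.trace) * h₂
end
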